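/- arXiv:2004.04965 — 4 statements merged into one kernel-verified Lean document; each statement's English description precedes it below -/
import Mathlib

section
/- Let σ : Γ × Ω → H be a strict measurable cocycle and let ψ : H^{n+1} → ℝ be bounded, measurable, and H-invariant, i.e. ψ(h·h₀, …, h·hₙ) = ψ(h₀, …, hₙ) for all h, h₀, …, hₙ ∈ H. Then the function C^n_b(σ)(ψ) : Γ^{n+1} → ℝ is Γ-invariant: C^n_b(σ)(ψ)(γγ₀, …, γγₙ) = C^n_b(σ)(ψ)(γ₀, …, γₙ) for all γ, γ₀, …, γₙ ∈ Γ. -/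
open MeasureTheory

/-- Γ-invariance of the pullback cochain `C^n_b(σ)(ψ)` defined by
`C^n_b(σ)(ψ)(γ₀, …, γₙ) = ∫_Ω ψ(σ(γ₀⁻¹, s)⁻¹, …, σ(γₙ⁻¹, s)⁻¹) dμ(s)`. -/
theorem stmt_0
    {Γ H Ω : Type*} [Group Γ] [Group H] [MeasurableSpace H]
    [MeasurableMul₂ H] [MeasurableInv H]
    [MeasurableSpace Ω] (μ : Measure Ω) [IsProbabilityMeasure μ]
    [MulAction Γ Ω]
    (hact : ∀ γ : Γ, MeasurePreserving (fun s : Ω => γ • s) μ μ)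
    (σ : Γ → Ω → H)
    (hσmeas : ∀ γ : Γ, Measurable (σ γ))
    (hσcoc : ∀ (γ₁ γ₂ : Γ) (s : Ω), σ (γ₁ * γ₂) s = σ γ₁ (γ₂ • s) * σ γ₂ s)
    (n : ℕ) (ψ : (Fin (n + 1) → H) → ℝ)
    (hψmeas : Measurable ψ)
    (hψbdd : ∃ C : ℝ, ∀ x, |ψ x| ≤ C)
    (hψinv : ∀ (h : H) (x : Fin (n + 1) → H), ψ (fun i => h * x i) = ψ x)
    (γ : Γ) (g : Fin (n + 1) → Γ) :
    ∫ s, ψ (fun i => (σ (γ * g i)⁻¹ s)⁻¹) ∂μ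
      = ∫ s, ψ (fun i => (σ (g i)⁻¹ s)⁻¹) ∂μ := by
  have hF : Measurable fun s => ψ (fun i => (σ (g i)⁻¹ s)⁻¹) :=
    hψmeas.comp (measurable_pi_lambda _ fun i => (hσmeas (g i)⁻¹).inv)
  have hcoc (s : Ω) : ψ (fun i => (σ (γ * g i)⁻¹ s)⁻¹)
      = ψ (fun i => (σ (g i)⁻¹ (γ⁻¹ • s))⁻¹) := by
    simp only [mul_inv_rev, hσcoc, hψinv]
  simp only [hcoc]
  have hint := integral_map (hact γ⁻¹).measurable.aemeasurable
    (hF.aestronglyMeasurable (μ := μ.map (fun s : Ω => γ⁻¹ • s)))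
  rw [(hact γ⁻¹).map_eq] at hint
  exact hint.symm
end

section
/- Let σ : Γ × Ω → H be a strict measurable cocycle. For every bounded measurable function ψ : H^{n+1} → ℝ one has C^{n+1}_b(σ)(δψ) = δ(C^n_b(σ)(ψ)) as functions on Γ^{n+2}; that is, the maps C^•_b(σ) commute with the homogeneous coboundary operators and hence form a cochain map. -/
open MeasureTheory

/-- The maps `C^•_b(σ)` commute with the homogeneous coboundary
operators: `C^{n+1}_b(σ)(δψ) = δ(C^n_b(σ)(ψ))` as functions on `Γ^{n+2}`. -/
theorem stmt_1
    {Γ H Ω : Type*} [Group Γ] [Group H] [MeasurableSpace H]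
    [MeasurableMul₂ H] [MeasurableInv H]
    [MeasurableSpace Ω] (μ : Measure Ω) [IsProbabilityMeasure μ]
    [MulAction Γ Ω]
    (hact : ∀ γ : Γ, MeasurePreserving (fun s : Ω => γ • s) μ μ)
    (σ : Γ → Ω → H)
    (hσmeas : ∀ γ : Γ, Measurable (σ γ))
    (hσcoc : ∀ (γ₁ γ₂ : Γ) (s : Ω), σ (γ₁ * γ₂) s = σ γ₁ (γ₂ • s) * σ γ₂ s)
    (n : ℕ) (ψ : (Fin (n + 1) → H) → ℝ)
    (hψmeas : Measurable ψ)
    (hψbdd : ∃ C : ℝ, ∀ x, |ψ x| ≤ C)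
    (g : Fin (n + 2) → Γ) :
    ∫ s, (∑ i : Fin (n + 2), (-1 : ℝ) ^ (i : ℕ) *
        ψ (fun j => (σ (g (i.succAbove j))⁻¹ s)⁻¹)) ∂μ
      = ∑ i : Fin (n + 2), (-1 : ℝ) ^ (i : ℕ) *
          ∫ s, ψ (fun j => (σ (g (i.succAbove j))⁻¹ s)⁻¹) ∂μ := by
  obtain ⟨C, hC⟩ := hψbdd
  have hint (i : Fin (n + 2)) :
      Integrable (fun s => ψ (fun j => (σ (g (i.succAbove j))⁻¹ s)⁻¹)) μ := by
    refine Integrable.of_bound (Measurable.aestronglyMeasurable ?_) C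
      (Filter.Eventually.of_forall fun s => hC _)
    exact hψmeas.comp (measurable_pi_lambda _ fun j => (hσmeas _).inv)
  rw [integral_finsetSum _ fun i _ => (hint i).const_mul _]
  simp only [integral_const_mul]
end

section
/- Let σ : Γ × Ω → H be a strict measurable cocycle, let f : Ω → H be a measurable map, and let σ^f be the f-twisted cocycle. Fix n ≥ 1 and let ψ : H^{n+1} → ℝ be bounded, measurable, H-invariant (ψ(h·h₀, …, h·hₙ) = ψ(h₀, …, hₙ) for all h, hᵢ ∈ H), and a cocycle, i.e. δψ = 0 on H^{n+2}. Then there exists a bounded Γ-invariant function η : Γ^n → ℝ (i.e. η(γγ₁, …, γγₙ) = η(γ₁, …, γₙ) for all γ, γᵢ ∈ Γ) such that C^n_b(σ)(ψ) − C^n_b(σ^f)(ψ) = δη on Γ^{n+1}. In particular, cohomologous measurable cocycles induce the same map on bounded cohomology classes. -/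
open MeasureTheory

/-- The `k`-th simplex `(x₀, …, x_k, y_k, …, y_{m-1})` of the prism with bottom `x` and top `y`. -/
def prismSimplex {H : Type*} {m : ℕ} (x y : Fin m → H) (k : Fin m) : Fin (m + 1) → H :=
  fun j => if j ≤ k.castSucc then x (k.predAbove j) else y (k.predAbove j)

/-- The prism operator: minus the alternating sum of the values of `ψ` on the simplices of the
prism between `x` and `y`. -/
def prismSum {H : Type*} {m : ℕ} (ψ : (Fin (m + 1) → H) → ℝ) (x y : Fin m → H) : ℝ :=
  -∑ k : Fin m, (-1 : ℝ) ^ (k : ℕ) * ψ (prismSimplex x y k)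

theorem Fin.val_succAbove_eq_ite {n : ℕ} (p : Fin (n + 1)) (i : Fin n) :
    (p.succAbove i : ℕ) = if (i : ℕ) < p then (i : ℕ) else i + 1 := by
  simp only [Fin.succAbove, Fin.lt_def, Fin.val_castSucc]
  split_ifs <;> rfl

theorem Fin.val_predAbove_eq_ite {n : ℕ} (p : Fin n) (i : Fin (n + 1)) :
    (p.predAbove i : ℕ) = if (p : ℕ) < i then (i : ℕ) - 1 else i := by
  simp only [Fin.predAbove, Fin.lt_def, Fin.val_castSucc]
  split_ifs <;> rfl

theorem prismSimplex_comp_castSucc_succAbove {H : Type*} {m : ℕ} (x y : Fin m → H) (k : Fin m) :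
    (fun j => prismSimplex x y k (k.castSucc.succAbove j)) =
      fun j : Fin m => if (j : ℕ) < k then x j else y j := by
  have hle (j : Fin m) : k.castSucc.succAbove j ≤ k.castSucc ↔ (j : ℕ) < k := by
    simp only [Fin.le_def, Fin.val_succAbove_eq_ite, Fin.val_castSucc]
    split_ifs <;> omega
  simp only [prismSimplex, hle, Fin.predAbove_succAbove]

theorem prismSimplex_comp_succ_succAbove {H : Type*} {m : ℕ} (x y : Fin m → H) (k : Fin m) :
    (fun j => prismSimplex x y k (k.succ.succAbove j)) =
      fun j : Fin m => if (j : ℕ) < k + 1 then x j else y j := by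
  have hle (j : Fin m) : k.succ.succAbove j ≤ k.castSucc ↔ (j : ℕ) < k + 1 := by
    simp only [Fin.le_def, Fin.val_succAbove_eq_ite, Fin.val_castSucc, Fin.val_succ]
    split_ifs <;> omega
  have hpred (j : Fin m) : k.predAbove (k.succ.succAbove j) = j := by
    simp only [Fin.ext_iff, Fin.val_predAbove_eq_ite, Fin.val_succAbove_eq_ite, Fin.val_succ]
    split_ifs <;> omega
  simp only [prismSimplex, hle, hpred]

theorem prismSimplex_comp_succAbove_succAbove {H : Type*} {n : ℕ} (x y : Fin (n + 1) → H)
    (k : Fin (n + 1)) (i : Fin n) :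
    (fun j => prismSimplex x y k ((k.castSucc.succAbove (k.succAbove i)).succAbove j)) =
      prismSimplex (fun j => x ((k.succAbove i).succAbove j))
        (fun j => y ((k.succAbove i).succAbove j)) (i.predAbove k) := by
  have hle (j : Fin (n + 1)) :
      (k.castSucc.succAbove (k.succAbove i)).succAbove j ≤ k.castSucc ↔
        j ≤ (i.predAbove k).castSucc := by
    simp only [Fin.le_def, Fin.val_succAbove_eq_ite, Fin.val_predAbove_eq_ite, Fin.val_castSucc]
    split_ifs <;> omega
  have hpred (j : Fin (n + 1)) :
      k.predAbove ((k.castSucc.succAbove (k.succAbove i)).succAbove j) =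
        (k.succAbove i).succAbove ((i.predAbove k).predAbove j) := by
    simp only [Fin.ext_iff, Fin.val_succAbove_eq_ite, Fin.val_predAbove_eq_ite, Fin.val_castSucc]
    split_ifs <;> omega
  funext j
  simp only [prismSimplex, hle, hpred]

/-- The prism operator is a chain homotopy between the two ends of the prism. -/
theorem sub_eq_sum_prismSum {H : Type*} {n : ℕ} (ψ : (Fin (n + 1) → H) → ℝ)
    (hψ : ∀ x : Fin (n + 2) → H,
      ∑ i : Fin (n + 2), (-1 : ℝ) ^ (i : ℕ) * ψ (fun j => x (i.succAbove j)) = 0)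
    (x y : Fin (n + 1) → H) :
    ψ x - ψ y = ∑ i : Fin (n + 1), (-1 : ℝ) ^ (i : ℕ) *
      prismSum ψ (fun j => x (i.succAbove j)) (fun j => y (i.succAbove j)) := by
  set w : ℕ → ℝ := fun k => ψ fun j => if (j : ℕ) < k then x j else y j with hw
  set G : Fin (n + 1) → Fin n → ℝ := fun i k => (-1 : ℝ) ^ (i : ℕ) * ((-1 : ℝ) ^ (k : ℕ) *
    ψ (prismSimplex (fun j => x (i.succAbove j)) (fun j => y (i.succAbove j)) k)) with hG
  have hface (k : Fin (n + 1)) :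
      (w k - w (k + 1)) - ∑ i : Fin n, G (k.succAbove i) (i.predAbove k) = 0 := by
    have h := congrArg (fun r => (-1 : ℝ) ^ (k : ℕ) * r) (hψ (prismSimplex x y k))
    simp only [mul_zero] at h
    rw [Fin.sum_univ_succAbove _ k.castSucc, Fin.sum_univ_succAbove _ k, Fin.succAbove_castSucc_self,
      prismSimplex_comp_castSucc_succAbove, prismSimplex_comp_succ_succAbove] at h
    simp only [prismSimplex_comp_succAbove_succAbove] at h
    rw [← h, mul_add, mul_add, Finset.mul_sum, sub_eq_add_neg, ← Finset.sum_neg_distrib,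
      ← add_assoc]
    have hsq : (-1 : ℝ) ^ (k : ℕ) * (-1 : ℝ) ^ (k : ℕ) = 1 := by
      rw [← pow_add, Even.neg_one_pow ⟨_, rfl⟩]
    congr 1
    · simp only [hw, Fin.val_castSucc, Fin.val_succ, pow_succ]
      linear_combination (-(ψ fun j => if (j : ℕ) < k then x j else y j) +
        ψ fun j => if (j : ℕ) < k + 1 then x j else y j) * hsq
    · refine Finset.sum_congr rfl fun i _ => ?_
      simp only [hG, ← mul_assoc, ← neg_mul]
      congr 1
      rcases lt_or_ge (i : ℕ) k with hik | hik
      · obtain ⟨c, hc⟩ : ∃ c, (k : ℕ) = c + 1 := ⟨k - 1, by omega⟩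
        have hic : (i : ℕ) < c + 1 := by omega
        simp [Fin.succAbove, Fin.predAbove, Fin.lt_def, hc, hic, pow_succ]
        ring
      · have h₁ : ¬ (i : ℕ) < k := by omega
        have h₂ : ¬ (i : ℕ) + 1 < k := by omega
        simp [Fin.succAbove, Fin.predAbove, Fin.lt_def, h₁, h₂, pow_succ]
        ring
  have hsum := Finset.sum_congr (rfl : (Finset.univ : Finset (Fin (n + 1))) = _) fun k _ => hface k
  have htel : ∑ k : Fin (n + 1), (w k - w (k + 1)) = ψ y - ψ x := by
    rw [Fin.sum_univ_eq_sum_range (fun k => w k - w (k + 1)), Finset.sum_range_sub']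
    simp [hw, Fin.is_le]
  have hswap : ∑ k : Fin (n + 1), ∑ i : Fin n, G (k.succAbove i) (i.predAbove k) =
      ∑ k : Fin (n + 1), ∑ i : Fin n, G k i := by
    have hinv : Function.Involutive fun p : Fin (n + 1) × Fin n =>
        (p.1.succAbove p.2, p.2.predAbove p.1) := fun p => by
      simp [Fin.succAbove_succAbove_predAbove, Fin.predAbove_predAbove_succAbove]
    rw [← Fintype.sum_prod_type', ← Fintype.sum_prod_type']
    exact Equiv.sum_comp hinv.toPerm fun p => G p.1 p.2
  rw [Finset.sum_sub_distrib, htel, hswap, Finset.sum_const_zero] at hsum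
  simp only [prismSum, mul_neg, Finset.sum_neg_distrib, Finset.mul_sum]
  linarith

theorem prismSum_mul_left {H : Type*} [Group H] {m : ℕ} {ψ : (Fin (m + 1) → H) → ℝ}
    (hψ : ∀ (h : H) (x : Fin (m + 1) → H), ψ (fun i => h * x i) = ψ x) (h : H)
    (x y : Fin m → H) :
    prismSum ψ (fun i => h * x i) (fun i => h * y i) = prismSum ψ x y := by
  have hk (k : Fin m) : prismSimplex (fun i => h * x i) (fun i => h * y i) k =
      fun j => h * prismSimplex x y k j := by
    funext j
    simp only [prismSimplex, mul_ite]
  simp only [prismSum, hk, hψ]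

theorem abs_prismSum_le {H : Type*} {m : ℕ} {ψ : (Fin (m + 1) → H) → ℝ} {C : ℝ}
    (hψ : ∀ x, |ψ x| ≤ C) (x y : Fin m → H) : |prismSum ψ x y| ≤ m * C := by
  rw [prismSum, abs_neg]
  refine (Finset.abs_sum_le_sum_abs _ _).trans
    ((Finset.sum_le_sum fun k _ => ?_).trans_eq (b := ∑ _k : Fin m, C) (by simp))
  simpa [abs_mul] using hψ _

theorem Measurable.prismSum {H Ω : Type*} [MeasurableSpace H] [MeasurableSpace Ω] {m : ℕ}
    {ψ : (Fin (m + 1) → H) → ℝ} (hψ : Measurable ψ) {x y : Ω → Fin m → H} (hx : Measurable x)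
    (hy : Measurable y) : Measurable fun s => prismSum ψ (x s) (y s) := by
  refine (Finset.measurable_sum _ fun k _ =>
    (hψ.comp (measurable_pi_lambda _ fun j => ?_)).const_mul _).neg
  by_cases h : j ≤ k.castSucc
  · simpa only [prismSimplex, h, if_true] using measurable_pi_iff.1 hx _
  · simpa only [prismSimplex, h, if_false] using measurable_pi_iff.1 hy _

theorem MeasureTheory.Integrable.of_measurable_abs_le {Ω : Type*} [MeasurableSpace Ω]
    {μ : Measure Ω} [IsFiniteMeasure μ] {u : Ω → ℝ} (hu : Measurable u) {C : ℝ}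
    (hC : ∀ s, |u s| ≤ C) : Integrable u μ :=
  .of_bound hu.aestronglyMeasurable C (.of_forall hC)

/-- If `ψ` is a bounded measurable `H`-invariant cocycle (`δψ = 0`),
then for a measurable `f : Ω → H` the cochains `C^n_b(σ)(ψ)` and `C^n_b(σ^f)(ψ)`
differ by the coboundary of a bounded Γ-invariant function `η : Γ^n → ℝ`. -/
theorem stmt_2
    {Γ H Ω : Type*} [Group Γ] [Group H] [MeasurableSpace H]
    [MeasurableMul₂ H] [MeasurableInv H]
    [MeasurableSpace Ω] (μ : Measure Ω) [IsProbabilityMeasure μ]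
    [MulAction Γ Ω]
    (hact : ∀ γ : Γ, MeasurePreserving (fun s : Ω => γ • s) μ μ)
    (σ : Γ → Ω → H)
    (hσmeas : ∀ γ : Γ, Measurable (σ γ))
    (hσcoc : ∀ (γ₁ γ₂ : Γ) (s : Ω), σ (γ₁ * γ₂) s = σ γ₁ (γ₂ • s) * σ γ₂ s)
    (f : Ω → H) (hfmeas : Measurable f)
    (n : ℕ) (hn : 1 ≤ n) (ψ : (Fin (n + 1) → H) → ℝ)
    (hψmeas : Measurable ψ)
    (hψbdd : ∃ C : ℝ, ∀ x, |ψ x| ≤ C)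
    (hψinv : ∀ (h : H) (x : Fin (n + 1) → H), ψ (fun i => h * x i) = ψ x)
    (hψcoc : ∀ x : Fin (n + 2) → H,
      ∑ i : Fin (n + 2), (-1 : ℝ) ^ (i : ℕ) * ψ (fun j => x (i.succAbove j)) = 0) :
    ∃ η : (Fin n → Γ) → ℝ,
      (∃ C : ℝ, ∀ x, |η x| ≤ C) ∧
      (∀ (γ : Γ) (x : Fin n → Γ), η (fun i => γ * x i) = η x) ∧
      (∀ g : Fin (n + 1) → Γ,
        (∫ s, ψ (fun i => (σ (g i)⁻¹ s)⁻¹) ∂μ)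
          - (∫ s, ψ (fun i => ((f ((g i)⁻¹ • s))⁻¹ * σ (g i)⁻¹ s * f s)⁻¹) ∂μ)
        = ∑ i : Fin (n + 1), (-1 : ℝ) ^ (i : ℕ) * η (fun j => g (i.succAbove j))) := by
  obtain ⟨C, hC⟩ := hψbdd
  set a : Γ → Ω → H := fun g s => (σ g⁻¹ s)⁻¹ with ha
  set b : Γ → Ω → H := fun g s => a g s * f (g⁻¹ • s) with hb
  have ham (g : Γ) : Measurable (a g) := (hσmeas g⁻¹).inv
  have hbm (g : Γ) : Measurable (b g) := (ham g).mul (hfmeas.comp (hact g⁻¹).measurable)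
  have ha_mul (γ g : Γ) (s : Ω) : a (γ * g) s = (σ γ⁻¹ s)⁻¹ * a g (γ⁻¹ • s) := by
    simp only [ha, mul_inv_rev, hσcoc]
  have hb_mul (γ g : Γ) (s : Ω) : b (γ * g) s = (σ γ⁻¹ s)⁻¹ * b g (γ⁻¹ • s) := by
    simp only [hb, ha_mul, mul_inv_rev, mul_smul, mul_assoc]
  have hpm {m : ℕ} {c : Γ → Ω → H} (hc : ∀ g, Measurable (c g)) (g : Fin m → Γ) :
      Measurable fun s i => c (g i) s := measurable_pi_lambda _ fun i => hc (g i)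
  have hPm (g : Fin n → Γ) : Measurable fun s =>
      prismSum ψ (fun i => a (g i) s) (fun i => b (g i) s) :=
    hψmeas.prismSum (hpm ham g) (hpm hbm g)
  refine ⟨fun g => ∫ s, prismSum ψ (fun i => a (g i) s) (fun i => b (g i) s) ∂μ,
    ⟨n * C, fun g => ?_⟩, fun γ g => ?_, fun g => ?_⟩
  · have hle : ∀ᵐ s ∂μ, ‖prismSum ψ (fun i => a (g i) s) fun i => b (g i) s‖ ≤ n * C :=
      .of_forall fun s => abs_prismSum_le hC _ _
    simpa using norm_integral_le_of_norm_le_const hle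
  · simp only [ha_mul, hb_mul, prismSum_mul_left hψinv]
    have h := integral_map (μ := μ) (hact γ⁻¹).measurable.aemeasurable
      (hPm g).aestronglyMeasurable
    rw [(hact γ⁻¹).map_eq] at h
    exact h.symm
  · have htwist (s : Ω) : ψ (fun i => ((f ((g i)⁻¹ • s))⁻¹ * σ (g i)⁻¹ s * f s)⁻¹) =
        ψ fun i => b (g i) s := by
      rw [← hψinv (f s)⁻¹ fun i => b (g i) s]
      simp [hb, ha, mul_assoc]
    have hint {c : Γ → Ω → H} (hc : ∀ g, Measurable (c g)) :
        Integrable (fun s => ψ fun i => c (g i) s) μ :=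
      .of_measurable_abs_le (hψmeas.comp (hpm hc g)) fun s => hC _
    simp only [htwist]
    rw [← integral_sub (hint ham) (hint hbm)]
    simp only [← integral_const_mul]
    rw [← integral_finsetSum _ fun i _ => (Integrable.of_measurable_abs_le (hPm _)
      fun s => abs_prismSum_le hC _ _).const_mul _]
    exact integral_congr_ae (.of_forall fun s => sub_eq_sum_prismSum ψ hψcoc _ _)
end

section
/- Let σ : Γ × Ω → H be a strict measurable cocycle, let φ : B × Ω → Y be a measurable σ-equivariant map, and let ψ : Y^{n+1} → ℝ be bounded, measurable, and H-invariant, i.e. ψ(h·y₀, …, h·yₙ) = ψ(y₀, …, yₙ) for all h ∈ H and yᵢ ∈ Y. Then the function C^n(Φ^Ω)(ψ) : B^{n+1} → ℝ defined by C^n(Φ^Ω)(ψ)(ξ₀, …, ξₙ) := ∫_Ω ψ(φ(ξ₀, s), …, φ(ξₙ, s)) dμ(s) is Γ-invariant: C^n(Φ^Ω)(ψ)(γξ₀, …, γξₙ) = C^n(Φ^Ω)(ψ)(ξ₀, …, ξₙ) for every γ ∈ Γ and all ξ₀, …, ξₙ ∈ B. -/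
open MeasureTheory

/-- Γ-invariance of the pullback along a boundary map:
`C^n(Φ^Ω)(ψ)(ξ₀, …, ξₙ) = ∫_Ω ψ(φ(ξ₀, s), …, φ(ξₙ, s)) dμ(s)` is Γ-invariant. -/
theorem stmt_4
    {Γ H B Ω Y : Type*} [Group Γ] [Group H] [MeasurableSpace H]
    [MeasurableMul₂ H] [MeasurableInv H]
    [MeasurableSpace Ω] (μ : Measure Ω) [IsProbabilityMeasure μ]
    [MulAction Γ Ω]
    (hact : ∀ γ : Γ, MeasurePreserving (fun s : Ω => γ • s) μ μ)
    [MeasurableSpace B] [MulAction Γ B]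
    (hBact : ∀ γ : Γ, Measurable (fun b : B => γ • b))
    [MeasurableSpace Y] [MulAction H Y]
    (hYact : Measurable (fun p : H × Y => p.1 • p.2))
    (σ : Γ → Ω → H)
    (hσmeas : ∀ γ : Γ, Measurable (σ γ))
    (hσcoc : ∀ (γ₁ γ₂ : Γ) (s : Ω), σ (γ₁ * γ₂) s = σ γ₁ (γ₂ • s) * σ γ₂ s)
    (φ : B → Ω → Y)
    (hφmeas : Measurable (fun p : B × Ω => φ p.1 p.2))
    (hφequiv : ∀ (γ : Γ) (ξ : B) (s : Ω), φ (γ • ξ) (γ • s) = σ γ s • φ ξ s)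
    (n : ℕ) (ψ : (Fin (n + 1) → Y) → ℝ)
    (hψmeas : Measurable ψ)
    (hψbdd : ∃ C : ℝ, ∀ y, |ψ y| ≤ C)
    (hψinv : ∀ (h : H) (y : Fin (n + 1) → Y), ψ (fun i => h • y i) = ψ y)
    (γ : Γ) (ξ : Fin (n + 1) → B) :
    ∫ s, ψ (fun i => φ (γ • ξ i) s) ∂μ = ∫ s, ψ (fun i => φ (ξ i) s) ∂μ := by
  let e : Ω ≃ᵐ Ω :=
    { MulAction.toPerm γ with
      measurable_toFun := (hact γ).measurable
      measurable_invFun := (hact γ⁻¹).measurable }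
  have he : MeasurePreserving e μ μ := hact γ
  calc ∫ s, ψ (fun i => φ (γ • ξ i) s) ∂μ
      = ∫ s, ψ (fun i => φ (γ • ξ i) (γ • s)) ∂μ :=
        (he.integral_comp' fun s => ψ fun i => φ (γ • ξ i) s).symm
    _ = ∫ s, ψ (fun i => φ (ξ i) s) ∂μ := by simp only [hφequiv, hψinv]
end
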